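/- arXiv:2203.12523 — 2 statements merged into one kernel-verified Lean document; each statement's English description precedes it below -/
import Mathlib

section
/- There exist universal constants C ≥ c > 0 such that: (i) for all a, b ∈ (0,∞) with a ≤ b and all r ∈ ℝ, c·min{|1−r|^{-1}, log(b/a)}·(a^{1−r} + b^{1−r}) ≤ ∫_a^b x^{−r} dx ≤ C·min{|1−r|^{-1}, log(b/a)}·(a^{1−r} + b^{1−r}), where 0^{-1} is interpreted as ∞; and (ii) for all 0 < a < b < e^{-1} and r > 1, ∫_a^b x^{−r}(log(1/x))^{−2} dx ≤ C·min{1, log(log(1/a)/log(1/b))}·(log(1/b))^{-1} + C·min{(r−1)^{-1}, log(b/a)}·[(r−1)^{-1} + log(1/a)]^{−2}·a^{1−r}, and this upper bound can be reversed with C replaced by c. -/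
open MeasureTheory Set

lemma aux_E (u : ℝ) (hu : 0 ≤ u) : (1/2) * min 1 u ≤ 1 - Real.exp (-u) := by
  have h1 : Real.exp (-u) * (1 + u) ≤ 1 := by
    have h := Real.add_one_le_exp u
    have h2 : Real.exp (-u) * Real.exp u = 1 := by rw [← Real.exp_add]; simp
    nlinarith [Real.exp_pos (-u)]
  have hp := Real.exp_pos (-u)
  rcases le_total u 1 with h | h
  · rw [min_eq_right h]; nlinarith
  · rw [min_eq_left h]; nlinarith

lemma aux_pure (p L M m : ℝ) (hp : 0 < p) (hL : 0 ≤ L) (hM : 0 ≤ M)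
    (hm : m = M * Real.exp (-(p * L))) :
    (1/4) * min p⁻¹ L * (M + m) ≤ (M - m) / p ∧ (M - m) / p ≤ min p⁻¹ L * (M + m) := by
  have hu : 0 ≤ p * L := by positivity
  have h1 := aux_E (p * L) hu
  have h2 := Real.add_one_le_exp (-(p*L))
  have h3 : Real.exp (-(p*L)) ≤ 1 := by simpa using hu
  have h4 := Real.exp_pos (-(p*L))
  have hmin : min 1 (p * L) = p * min p⁻¹ L := by
    rw [mul_min_of_nonneg _ _ hp.le, mul_inv_cancel₀ hp.ne']
  set E := Real.exp (-(p*L))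
  have h5 : 1 - E ≤ min 1 (p*L) := by
    apply le_min <;> linarith
  rw [hmin] at h1 h5
  have h6 : 0 ≤ min p⁻¹ L := le_min (by positivity) hL
  set q := min p⁻¹ L
  subst hm
  have h7 : 0 ≤ p * q := by positivity
  have hMq : 0 ≤ M * (p * q) := by positivity
  constructor
  · rw [le_div_iff₀ hp]
    have := mul_le_mul_of_nonneg_left h1 hM
    have := mul_le_mul_of_nonneg_left h3 hMq
    linarith
  · rw [div_le_iff₀ hp]
    have := mul_le_mul_of_nonneg_left h5 hM
    have := mul_nonneg hMq h4.le
    linarith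

lemma part1 (a b r : ℝ) (ha : 0 < a) (hab : a ≤ b) :
    (1/4) * (if r = 1 then Real.log (b / a) else min |1 - r|⁻¹ (Real.log (b / a))) *
            (a ^ (1 - r) + b ^ (1 - r)) ≤
          (∫ x in a..b, x ^ (-r)) ∧
        (∫ x in a..b, x ^ (-r)) ≤
          (if r = 1 then Real.log (b / a) else min |1 - r|⁻¹ (Real.log (b / a))) *
            (a ^ (1 - r) + b ^ (1 - r)) := by
  have hb : 0 < b := lt_of_lt_of_le ha hab
  have hL : 0 ≤ Real.log (b / a) := Real.log_nonneg (by rwa [le_div_iff₀ ha, one_mul])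
  have h0 : (0:ℝ) ∉ Set.uIcc a b := by
    rw [Set.uIcc_of_le hab]; intro h; exact absurd h.1 (not_le.mpr ha)
  split_ifs with h
  · subst h
    have : (∫ x in a..b, x ^ (-(1:ℝ))) = Real.log (b / a) := by
      rw [← integral_inv h0]
      apply intervalIntegral.integral_congr
      intro x hx
      exact Real.rpow_neg_one x
    rw [this]; simp only [sub_self, Real.rpow_zero]
    constructor <;> linarith
  · have hI : (∫ x in a..b, x ^ (-r)) = (b ^ (1 - r) - a ^ (1 - r)) / (1 - r) := by
      rw [integral_rpow (Or.inr ⟨fun h' => h (by linarith), h0⟩)]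
      rw [show -r + 1 = 1 - r by ring]
    rw [hI]
    have hlog : Real.log (b/a) = Real.log b - Real.log a := Real.log_div hb.ne' ha.ne'
    have hs : 1 - r ≠ 0 := fun h' => h (by linarith)
    set s := 1 - r
    rcases lt_or_gt_of_ne hs with hs | hs
    · have := aux_pure (-s) (Real.log (b/a)) (a^s) (b^s) (by linarith) hL (by positivity) (by
        rw [Real.rpow_def_of_pos ha, Real.rpow_def_of_pos hb, ← Real.exp_add, hlog]
        congr 1; ring)
      rw [abs_of_neg hs]
      rw [show (b^s - a^s)/s = (a^s - b^s)/(-s) by rw [div_neg, ← neg_div]; ring]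
      exact this
    · have := aux_pure s (Real.log (b/a)) (b^s) (a^s) hs hL (by positivity) (by
        rw [Real.rpow_def_of_pos ha, Real.rpow_def_of_pos hb, ← Real.exp_add, hlog]
        congr 1; ring)
      rw [abs_of_pos hs, add_comm (a^s)]
      exact this

lemma pt_upper (s t A : ℝ) (hs : 0 < s) (ht : 1 < t) (htA : t ≤ A) :
    Real.exp (s*t) * (t^2)⁻¹ ≤ Real.exp 1 * (t^2)⁻¹ +
      16 * ((s⁻¹ + A)^2)⁻¹ * Real.exp (s*A/2) * Real.exp (s*t/2) := by
  have hsi : 0 < s⁻¹ := by positivity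
  rcases le_total (s*t) 1 with h | h
  · have : Real.exp (s*t) ≤ Real.exp 1 := Real.exp_le_exp.mpr h
    have h2 : Real.exp (s*t) * (t^2)⁻¹ ≤ Real.exp 1 * (t^2)⁻¹ := by gcongr
    have : 0 ≤ 16 * ((s⁻¹ + A)^2)⁻¹ * Real.exp (s*A/2) * Real.exp (s*t/2) := by positivity
    linarith
  · have h1 : s⁻¹ ≤ t := by rw [inv_le_iff_one_le_mul₀ hs]; linarith
    set d := s * (A - t) with hd
    have hd0 : 0 ≤ d := mul_nonneg hs.le (by linarith)
    have h2 : 1 + d ≤ 2 * Real.exp (d/4) := by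
      have := Real.quadratic_le_exp_of_nonneg (x := d/4) (by linarith)
      nlinarith [sq_nonneg (1 - d/4)]
    have h3 : s⁻¹ + A ≤ 4 * t * Real.exp (d/4) := by
      have e1 : (s⁻¹ + t) * (1 + d) = s⁻¹ + A + t * d := by
        rw [hd]; field_simp; ring
      have e2 : (s⁻¹ + t) * (1 + d) ≤ (2*t) * (2 * Real.exp (d/4)) := by
        gcongr; linarith
      have : 0 ≤ t * d := by positivity
      linarith
    have h4 : (s⁻¹ + A)^2 ≤ 16 * t^2 * Real.exp (d/2) := by
      have : (s⁻¹ + A)^2 ≤ (4 * t * Real.exp (d/4))^2 := by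
        apply pow_le_pow_left₀ (by linarith) h3
      have e : Real.exp (d/4)^2 = Real.exp (d/2) := by
        rw [← Real.exp_nat_mul]; congr 1; push_cast; ring
      rw [mul_pow, e] at this
      linarith
    have h5 : Real.exp (s*t) * (t^2)⁻¹ ≤
        16 * ((s⁻¹ + A)^2)⁻¹ * Real.exp (s*A/2) * Real.exp (s*t/2) := by
      have hP : 0 < (s⁻¹ + A)^2 := by have : 0 < s⁻¹ + A := by linarith
                                      positivity
      have hT : 0 < t^2 := by positivity
      rw [show 16 * ((s⁻¹ + A)^2)⁻¹ * Real.exp (s*A/2) * Real.exp (s*t/2) =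
        (16 * (Real.exp (s*A/2) * Real.exp (s*t/2))) / (s⁻¹ + A)^2 by ring,
        ← div_eq_mul_inv, div_le_div_iff₀ hT hP]
      have e : Real.exp (s*A/2) * Real.exp (s*t/2) = Real.exp (s*t) * Real.exp (d/2) := by
        rw [← Real.exp_add, ← Real.exp_add]; congr 1; rw [hd]; ring
      rw [e]
      have := mul_le_mul_of_nonneg_left h4 (Real.exp_pos (s*t)).le
      linarith
    have : 0 ≤ Real.exp 1 * (t^2)⁻¹ := by positivity
    linarith

lemma int_log (a b : ℝ) (ha : 0 < a) (hab : a < b) (hb : b < 1) :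
    IntervalIntegrable (fun x : ℝ => x⁻¹ * ((Real.log (1/x))^2)⁻¹) volume a b ∧
    (∫ x in a..b, x⁻¹ * ((Real.log (1/x))^2)⁻¹) =
      (Real.log (1/b))⁻¹ - (Real.log (1/a))⁻¹ := by
  have key : ∀ x ∈ Set.uIcc a b, 0 < x ∧ Real.log (1/x) ≠ 0 := by
    intro x hx
    rw [Set.uIcc_of_le hab.le] at hx
    have hx0 : 0 < x := lt_of_lt_of_le ha hx.1
    refine ⟨hx0, ?_⟩
    rw [one_div, Real.log_inv]
    have := Real.log_neg hx0 (lt_of_le_of_lt hx.2 hb)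
    linarith
  have hi : IntervalIntegrable (fun x : ℝ => x⁻¹ * ((Real.log (1/x))^2)⁻¹) volume a b := by
    apply ContinuousOn.intervalIntegrable
    intro x hx
    obtain ⟨h1, h2⟩ := key x hx
    have h3 : (1/x) ≠ 0 := by positivity
    have : ContinuousAt (fun x : ℝ => x⁻¹ * ((Real.log (1/x))^2)⁻¹) x := by
      have c1 : ContinuousAt (fun x : ℝ => 1/x) x := continuousAt_const.div continuousAt_id h1.ne'
      exact (continuousAt_inv₀ h1.ne').mul (((c1.log h3).pow 2).inv₀ (pow_ne_zero 2 h2))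
    exact this.continuousWithinAt
  refine ⟨hi, ?_⟩
  apply intervalIntegral.integral_eq_sub_of_hasDerivAt (f := fun x => (Real.log (1/x))⁻¹) _ hi
  intro x hx
  obtain ⟨h1, h2⟩ := key x hx
  have e : (fun x : ℝ => (Real.log (1/x))⁻¹) = fun x => (-Real.log x)⁻¹ := by
    funext y; rw [one_div, Real.log_inv]
  rw [e]
  rw [one_div, Real.log_inv] at h2 ⊢
  have := ((Real.hasDerivAt_log h1.ne').neg).inv h2
  refine this.congr_deriv ?_
  simp only [Pi.neg_apply, neg_neg, div_eq_mul_inv]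

lemma part2 (a b r : ℝ) (ha : 0 < a) (hab : a < b) (hb : b < (Real.exp 1)⁻¹) (hr : 1 < r) :
        (∫ x in a..b, x ^ (-r) * (Real.log (1 / x)) ^ (-(2 : ℝ))) ≤
          64 * min 1 (Real.log (Real.log (1 / a) / Real.log (1 / b))) *
              (Real.log (1 / b))⁻¹ +
            64 * min (r - 1)⁻¹ (Real.log (b / a)) *
              ((r - 1)⁻¹ + Real.log (1 / a)) ^ (-(2 : ℝ)) * a ^ (1 - r) ∧
        (1/8) * min 1 (Real.log (Real.log (1 / a) / Real.log (1 / b))) *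
              (Real.log (1 / b))⁻¹ +
            (1/8) * min (r - 1)⁻¹ (Real.log (b / a)) *
              ((r - 1)⁻¹ + Real.log (1 / a)) ^ (-(2 : ℝ)) * a ^ (1 - r) ≤
          (∫ x in a..b, x ^ (-r) * (Real.log (1 / x)) ^ (-(2 : ℝ))) := by
  have hb0 : 0 < b := ha.trans hab
  have hb1 : b < 1 := hb.trans (by
    rw [← Real.exp_neg]; simp)
  have hlt : ∀ x, 0 < x → x ≤ b → 1 < Real.log (1/x) := by
    intro x hx hxb
    have h : Real.exp 1 < 1/x := by
      rw [one_div]; exact (lt_inv_comm₀ (Real.exp_pos 1) hx).mpr (lt_of_le_of_lt hxb hb)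
    rwa [← Real.lt_log_iff_exp_lt (by positivity)] at h
  have hlA : ∀ x, 0 < x → a ≤ x → Real.log (1/x) ≤ Real.log (1/a) := by
    intro x hx hax
    exact Real.log_le_log (by positivity) (one_div_le_one_div_of_le ha hax)
  have hB := hlt b hb0 le_rfl
  have hA := hlt a ha hab.le
  have hBA : Real.log (1/b) ≤ Real.log (1/a) := hlA b hb0 hab.le
  have hrp : ∀ y : ℝ, 0 < y → y ^ (-(2:ℝ)) = (y^2)⁻¹ := by
    intro y hy; rw [Real.rpow_neg hy.le]; norm_num
  set s := r - 1 with hs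
  have hs0 : 0 < s := by linarith
  have hsi : 0 < s⁻¹ := by positivity
  have hexp : ∀ x : ℝ, 0 < x → x ^ (-r) = x⁻¹ * Real.exp (s * Real.log (1/x)) := by
    intro x hx
    rw [one_div, Real.log_inv, Real.rpow_def_of_pos hx, ← Real.exp_log (inv_pos.mpr hx),
      Real.log_inv, ← Real.exp_add]
    congr 1; rw [hs]; ring
  have hexp2 : ∀ x : ℝ, 0 < x → x ^ (-(1+s/2)) = x⁻¹ * Real.exp (s * Real.log (1/x)/2) := by
    intro x hx
    rw [one_div, Real.log_inv, Real.rpow_def_of_pos hx, ← Real.exp_log (inv_pos.mpr hx),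
      Real.log_inv, ← Real.exp_add]
    congr 1; ring
  have hI : (∫ x in a..b, x ^ (-r) * (Real.log (1 / x)) ^ (-(2 : ℝ))) =
      ∫ x in a..b, x ^ (-r) * ((Real.log (1/x))^2)⁻¹ := by
    apply intervalIntegral.integral_congr
    intro x hx
    rw [Set.uIcc_of_le hab.le] at hx
    have hx0 := lt_of_lt_of_le ha hx.1
    simp only
    rw [hrp _ (by linarith [hlt x hx0 hx.2])]
  rw [hI, hrp _ (by linarith)]
  obtain ⟨hi1, hv1⟩ := int_log a b ha hab hb1
  have h0 : (0:ℝ) ∉ Set.uIcc a b := by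
    rw [Set.uIcc_of_le hab.le]; intro h; exact absurd h.1 (not_le.mpr ha)
  have hi2 : ∀ p : ℝ, IntervalIntegrable (fun x : ℝ => x ^ p) volume a b := fun p =>
    intervalIntegral.intervalIntegrable_rpow (Or.inr h0)
  have hi3 : IntervalIntegrable (fun x : ℝ => x ^ (-r) * ((Real.log (1/x))^2)⁻¹) volume a b := by
    have : IntervalIntegrable (fun x : ℝ => x ^ (1-r) * (x⁻¹ * ((Real.log (1/x))^2)⁻¹))
        volume a b := by
      apply hi1.continuousOn_mul
      intro x hx
      exact (Real.continuousAt_rpow_const x _ (Or.inl (fun h => h0 (h ▸ hx)))).continuousWithinAt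
    refine this.congr ?_
    intro x hx
    rw [Set.uIoc_of_le hab.le] at hx
    have hx0 : 0 < x := lt_trans ha hx.1
    simp only
    rw [← mul_assoc, ← Real.rpow_neg_one x, ← Real.rpow_add hx0]
    congr 2; ring
  -- term one
  set A := Real.log (1/a) with hAdef
  set B := Real.log (1/b) with hBdef
  have hB0 : 0 < B := by linarith
  have hA0 : 0 < A := by linarith
  set u := Real.log (A/B) with hu
  have hu0 : 0 ≤ u := Real.log_nonneg (by rwa [le_div_iff₀ hB0, one_mul])
  have heu : Real.exp (-u) = B/A := by
    rw [hu, Real.exp_neg, Real.exp_log (by positivity), inv_div]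
  have hJ : B⁻¹ - A⁻¹ = (1 - Real.exp (-u)) * B⁻¹ := by
    rw [heu]; field_simp
  have hJl : (1/2) * min 1 u * B⁻¹ ≤ B⁻¹ - A⁻¹ := by
    rw [hJ]; exact mul_le_mul_of_nonneg_right (aux_E u hu0) (by positivity)
  have hJu : B⁻¹ - A⁻¹ ≤ min 1 u * B⁻¹ := by
    rw [hJ]; apply mul_le_mul_of_nonneg_right _ (by positivity)
    apply le_min
    · linarith [Real.exp_pos (-u)]
    · linarith [Real.add_one_le_exp (-u)]
  set L := Real.log (b/a) with hLdef
  have hL0 : 0 ≤ L := Real.log_nonneg (by rw [le_div_iff₀ ha]; linarith)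
  have has : 0 < a ^ (1-r) := Real.rpow_pos_of_pos ha _
  have hm0 : 0 ≤ min s⁻¹ L := le_min hsi.le hL0
  have hPp : 0 < (s⁻¹ + A)^2 := by positivity
  set P := ((s⁻¹ + A)^2)⁻¹ with hP
  have hP0 : 0 < P := by positivity
  have hmu : 0 ≤ min 1 u * B⁻¹ := mul_nonneg (le_min zero_le_one hu0) (by positivity)
  have hT2 : 0 ≤ min s⁻¹ L * P * a ^ (1-r) := by positivity
  constructor
  · have hle : (∫ x in a..b, x ^ (-r) * ((Real.log (1/x))^2)⁻¹) ≤
        ∫ x in a..b, (Real.exp 1 * (x⁻¹ * ((Real.log (1/x))^2)⁻¹) +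
          (16 * P * Real.exp (s*A/2)) * x ^ (-(1+s/2))) := by
      apply intervalIntegral.integral_mono_on hab.le hi3
        ((hi1.const_mul _).add ((hi2 _).const_mul _))
      intro x hx
      have hx0 : 0 < x := lt_of_lt_of_le ha hx.1
      have := pt_upper s (Real.log (1/x)) A hs0 (hlt x hx0 hx.2) (hlA x hx0 hx.1)
      have := mul_le_mul_of_nonneg_left this (inv_pos.mpr hx0).le
      rw [hexp x hx0, hexp2 x hx0]
      rw [← hP] at this
      linarith
    rw [intervalIntegral.integral_add (hi1.const_mul _) ((hi2 _).const_mul _),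
      intervalIntegral.integral_const_mul, intervalIntegral.integral_const_mul, hv1] at hle
    have h1 := (part1 a b (1+s/2) ha hab.le).2
    rw [if_neg (by linarith)] at h1
    have e1 : |1 - (1+s/2)|⁻¹ = 2 * s⁻¹ := by
      rw [show 1 - (1+s/2) = -(s/2) by ring, abs_neg, abs_of_pos (by positivity), inv_div]
      ring
    have e2 : min (2*s⁻¹) L ≤ 2 * min s⁻¹ L := by
      rw [mul_min_of_nonneg _ _ zero_le_two]
      exact min_le_min le_rfl (by linarith)
    have e3 : b ^ (1 - (1+s/2)) ≤ a ^ (1 - (1+s/2)) :=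
      Real.rpow_le_rpow_of_nonpos ha hab.le (by linarith)
    have e4 : Real.exp (s*A/2) * a ^ (1 - (1+s/2)) = a ^ (1-r) := by
      rw [Real.rpow_def_of_pos ha, Real.rpow_def_of_pos ha, ← Real.exp_add, hAdef, one_div,
        Real.log_inv]
      congr 1; rw [hs]; ring
    rw [e1] at h1
    have hap : 0 < a ^ (1 - (1+s/2)) := Real.rpow_pos_of_pos ha _
    have hbp : 0 < b ^ (1 - (1+s/2)) := Real.rpow_pos_of_pos hb0 _
    have h2 : (∫ x in a..b, x ^ (-(1+s/2))) ≤ (2 * min s⁻¹ L) * (2 * a ^ (1 - (1+s/2))) :=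
      h1.trans (mul_le_mul e2 (by linarith) (by positivity) (by positivity))
    have h3 := mul_le_mul_of_nonneg_left h2
      (show 0 ≤ 16 * P * Real.exp (s*A/2) by positivity)
    have e5 : 16 * P * Real.exp (s*A/2) * ((2 * min s⁻¹ L) * (2 * a ^ (1 - (1+s/2)))) =
        64 * min s⁻¹ L * P * a ^ (1-r) := by rw [← e4]; ring
    rw [e5] at h3
    have h4 := mul_le_mul_of_nonneg_left hJu (Real.exp_pos 1).le
    have h5 : Real.exp 1 * (min 1 u * B⁻¹) ≤ 64 * (min 1 u * B⁻¹) :=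
      mul_le_mul_of_nonneg_right (by linarith [Real.exp_one_lt_d9]) hmu
    linarith
  · have l1 : B⁻¹ - A⁻¹ ≤ ∫ x in a..b, x ^ (-r) * ((Real.log (1/x))^2)⁻¹ := by
      rw [← hv1]
      apply intervalIntegral.integral_mono_on hab.le hi1 hi3
      intro x hx
      have hx0 : 0 < x := lt_of_lt_of_le ha hx.1
      have ht := hlt x hx0 hx.2
      rw [hexp x hx0]
      have : 1 ≤ Real.exp (s * Real.log (1/x)) := Real.one_le_exp (by positivity)
      apply mul_le_mul_of_nonneg_right _ (by positivity)
      exact le_mul_of_one_le_right (by positivity) this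
    have l2 : (∫ x in a..b, x ^ (-r)) * P ≤ ∫ x in a..b, x ^ (-r) * ((Real.log (1/x))^2)⁻¹ := by
      rw [← intervalIntegral.integral_mul_const]
      apply intervalIntegral.integral_mono_on hab.le ((hi2 _).mul_const _) hi3
      intro x hx
      have hx0 : 0 < x := lt_of_lt_of_le ha hx.1
      have ht := hlt x hx0 hx.2
      have htA := hlA x hx0 hx.1
      apply mul_le_mul_of_nonneg_left _ (by positivity)
      apply inv_anti₀ (by positivity)
      apply pow_le_pow_left₀ (by linarith)
      linarith
    have h1 := (part1 a b r ha hab.le).1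
    rw [if_neg (by linarith), abs_sub_comm, abs_of_pos (show 0 < r - 1 by linarith), ← hs] at h1
    have hbp : 0 < b ^ (1 - r) := Real.rpow_pos_of_pos hb0 _
    have h2 : (1/4) * min s⁻¹ L * a ^ (1-r) ≤ ∫ x in a..b, x ^ (-r) := by
      refine le_trans ?_ h1
      apply mul_le_mul_of_nonneg_left (by linarith) (by positivity)
    have h3 := mul_le_mul_of_nonneg_right h2 hP0.le
    linarith

/-- There exist universal constants `C ≥ c > 0` such that:
(i) for all `0 < a ≤ b` and `r ∈ ℝ`,
`c·min{|1−r|⁻¹, log(b/a)}·(a^{1−r}+b^{1−r}) ≤ ∫_a^b x^{−r} dx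
  ≤ C·min{|1−r|⁻¹, log(b/a)}·(a^{1−r}+b^{1−r})`,
where for `r = 1` the quantity `|1−r|⁻¹ = 0⁻¹` is interpreted as `∞`, i.e. the minimum is
then `log(b/a)`; and
(ii) for all `0 < a < b < e⁻¹` and `r > 1`,
`∫_a^b x^{−r}(log(1/x))^{−2} dx
  ≤ C·min{1, log(log(1/a)/log(1/b))}·(log(1/b))⁻¹
   + C·min{(r−1)⁻¹, log(b/a)}·((r−1)⁻¹+log(1/a))^{−2}·a^{1−r}`,
with the reversed lower bound obtained by replacing `C` with `c`. -/
theorem stmt_15 :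
    ∃ C c : ℝ, 0 < c ∧ c ≤ C ∧
      (∀ a b r : ℝ, 0 < a → a ≤ b →
        c * (if r = 1 then Real.log (b / a) else min |1 - r|⁻¹ (Real.log (b / a))) *
            (a ^ (1 - r) + b ^ (1 - r)) ≤
          (∫ x in a..b, x ^ (-r)) ∧
        (∫ x in a..b, x ^ (-r)) ≤
          C * (if r = 1 then Real.log (b / a) else min |1 - r|⁻¹ (Real.log (b / a))) *
            (a ^ (1 - r) + b ^ (1 - r))) ∧
      (∀ a b r : ℝ, 0 < a → a < b → b < (Real.exp 1)⁻¹ → 1 < r →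
        (∫ x in a..b, x ^ (-r) * (Real.log (1 / x)) ^ (-(2 : ℝ))) ≤
          C * min 1 (Real.log (Real.log (1 / a) / Real.log (1 / b))) *
              (Real.log (1 / b))⁻¹ +
            C * min (r - 1)⁻¹ (Real.log (b / a)) *
              ((r - 1)⁻¹ + Real.log (1 / a)) ^ (-(2 : ℝ)) * a ^ (1 - r) ∧
        c * min 1 (Real.log (Real.log (1 / a) / Real.log (1 / b))) *
              (Real.log (1 / b))⁻¹ +
            c * min (r - 1)⁻¹ (Real.log (b / a)) *
              ((r - 1)⁻¹ + Real.log (1 / a)) ^ (-(2 : ℝ)) * a ^ (1 - r) ≤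
          (∫ x in a..b, x ^ (-r) * (Real.log (1 / x)) ^ (-(2 : ℝ)))) := by
  refine ⟨64, 1/8, by norm_num, by norm_num, ?_, ?_⟩
  · intro a b r ha hab
    obtain ⟨h1, h2⟩ := part1 a b r ha hab
    have hb : 0 < b := lt_of_lt_of_le ha hab
    have hL : 0 ≤ Real.log (b / a) := Real.log_nonneg (by rwa [le_div_iff₀ ha, one_mul])
    have hq : 0 ≤ (if r = 1 then Real.log (b / a) else min |1 - r|⁻¹ (Real.log (b / a))) := by
      split_ifs
      · exact hL
      · exact le_min (by positivity) hL
    have hS : 0 ≤ a ^ (1 - r) + b ^ (1 - r) := by positivity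
    have := mul_nonneg hq hS
    constructor <;> linarith
  · intro a b r ha hab hb hr
    exact part2 a b r ha hab hb hr
end

section
/- There exists a universal constant C > 0 such that the following holds. Let p > 1, n ∈ ℕ, λ > 0, and let (Y_i)_{i=1}^n be an i.i.d. sequence of non-negative random variables with cumulative distribution function F(x) = min{1, 1 − x^{−p}} for x ≥ 1 (quantile function F^{-1}(x) = (1−x)^{−1/p}, i.e. the Pareto distribution ℙ{Y_i > t} = t^{−p} for t ≥ 1), with order statistics Y_{(1)} ≤ … ≤ Y_{(n)}. Then with probability at least 1 − C·exp(−λ²/2), the following event occurs: for every integer j with 0 ≤ j ≤ n/2, ∑_{i=1}^{n−j} Y_{(i)} ≤ C·p·n/(p−1) + C·(1 + (j+1)·min{(λ²/(p(j+1)))², (λ²/(p(j+1)))^{-1}})·(n/(j+1))^{1/p}·exp(λ²/(2p(j+1))). -/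
open MeasureTheory Set

/-- The `k`-th order statistic (`0`-indexed: `orderStat v k` is the `(k+1)`-th smallest
value) of a tuple `v : Fin n → ℝ`. -/
noncomputable def orderStat {n : ℕ} (v : Fin n → ℝ) (k : Fin n) : ℝ :=
  v (Tuple.sort v k)

lemma aux_sum_rpow (q : ℝ) (hq0 : 0 < q) (hq1 : q ≤ 1) (N : ℕ) :
    ∑ m ∈ Finset.Icc 1 N, q * (m : ℝ) ^ (q - 1) ≤ (N : ℝ) ^ q := by
  induction N with
  | zero => simp [Real.zero_rpow hq0.ne']
  | succ N ih =>
    rw [Finset.sum_Icc_succ_top (by omega)]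
    have hM : (0 : ℝ) < (N : ℝ) + 1 := by positivity
    have hb := rpow_one_add_le_one_add_mul_self (s := -(1 / ((N : ℝ) + 1))) (p := q)
      (by rw [neg_le_neg_iff, div_le_one hM]; linarith [(Nat.cast_nonneg N : (0:ℝ) ≤ N)])
      hq0.le hq1
    have e1 : (N : ℝ) = ((N : ℝ) + 1) * (1 + -(1 / ((N : ℝ) + 1))) := by field_simp; ring
    have e2 : (N : ℝ) ^ q = ((N : ℝ) + 1) ^ q * (1 + -(1 / ((N : ℝ) + 1))) ^ q := by
      rw [← Real.mul_rpow hM.le, ← e1]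
      have : 1 + -(1 / ((N : ℝ) + 1)) = N / ((N:ℝ)+1) := by field_simp; ring
      rw [this]; positivity
    have e3 : ((N : ℝ) + 1) ^ (q - 1) = ((N : ℝ) + 1) ^ q * (1 / ((N : ℝ) + 1)) := by
      rw [Real.rpow_sub_one hM.ne']; ring
    have := mul_le_mul_of_nonneg_left hb (Real.rpow_nonneg hM.le q)
    push_cast
    rw [e3]
    rw [← e2] at this
    nlinarith

lemma aux_sum1 (p : ℝ) (hp : 1 < p) (n : ℕ) :
    ∑ m ∈ Finset.Icc 1 n, ((n : ℝ) / m) ^ (1 / p) ≤ p * n / (p - 1) := by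
  have hp0 : 0 < p := by linarith
  rcases Nat.eq_zero_or_pos n with rfl | hn
  · simp
  have hn' : (0 : ℝ) < n := by exact_mod_cast hn
  have hq0 : 0 < 1 - 1 / p := by
    have : 1 / p < 1 := by rw [div_lt_one hp0]; exact hp
    linarith
  have h := aux_sum_rpow (1 - 1 / p) hq0 (by have : 0 < 1 / p := by positivity
                                             linarith) n
  rw [← Finset.mul_sum] at h
  have e : ∑ m ∈ Finset.Icc 1 n, ((n : ℝ) / m) ^ (1 / p)
      = (n : ℝ) ^ (1 / p) * ∑ m ∈ Finset.Icc 1 n, (m : ℝ) ^ (1 - 1 / p - 1) := by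
    rw [Finset.mul_sum]
    refine Finset.sum_congr rfl fun m _ => ?_
    rw [Real.div_rpow hn'.le (Nat.cast_nonneg m), show 1 - 1 / p - 1 = -(1 / p) by ring,
      Real.rpow_neg (Nat.cast_nonneg m)]
    rfl
  rw [e]
  have h2 : ∑ m ∈ Finset.Icc 1 n, (m : ℝ) ^ (1 - 1 / p - 1) ≤ (n : ℝ) ^ (1 - 1 / p) / (1 - 1 / p) := by
    rw [le_div_iff₀ hq0]; linarith
  refine (mul_le_mul_of_nonneg_left h2 (Real.rpow_nonneg hn'.le _)).trans (le_of_eq ?_)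
  rw [mul_div_assoc', ← Real.rpow_add hn']
  rw [show 1 / p + (1 - 1 / p) = 1 by ring, Real.rpow_one]
  have : p - 1 ≠ 0 := by linarith
  field_simp

lemma aux_geom (b : ℝ) (hb : 0 < b) (N : ℕ) :
    ∑ d ∈ Finset.range N, Real.exp (-(b * d)) ≤ 1 + 1 / b := by
  have hr0 : 0 ≤ Real.exp (-b) := (Real.exp_pos _).le
  have hr1 : Real.exp (-b) < 1 := by rw [Real.exp_lt_one_iff]; linarith
  have e : ∑ d ∈ Finset.range N, Real.exp (-(b * d)) = ∑ d ∈ Finset.range N, Real.exp (-b) ^ d := by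
    refine Finset.sum_congr rfl fun d _ => ?_
    rw [← Real.exp_nat_mul]; congr 1; ring
  rw [e]
  have h1 := (summable_geometric_of_lt_one hr0 hr1).sum_le_tsum (Finset.range N)
    (fun i _ => pow_nonneg hr0 i)
  rw [tsum_geometric_of_lt_one hr0 hr1] at h1
  refine h1.trans ?_
  rw [inv_le_comm₀ (by linarith) (by positivity)]
  have h2 : Real.exp (-b) ≤ 1 / (1 + b) := by
    rw [Real.exp_neg, ← one_div]
    apply one_div_le_one_div_of_le (by positivity)
    linarith [Real.add_one_le_exp b]
  have : (1 + 1 / b)⁻¹ = 1 - 1 / (1 + b) := by field_simp; ring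
  rw [this]; linarith

/-- sum over `k < a` -/
lemma aux_sum2 (a : ℝ) (k : ℕ) (hk : 1 ≤ k) (hka : (k : ℝ) < a) (n : ℕ) :
    ∑ m ∈ (Finset.Icc k n).filter (fun m : ℕ => (m : ℝ) < a), Real.exp (a / (2 * m))
      ≤ 36 * (1 + (k : ℝ) ^ 2 / a) * Real.exp (a / (2 * k)) := by
  have hk0 : (0 : ℝ) < k := by exact_mod_cast hk
  have ha0 : 0 < a := hk0.trans hka
  set S := (Finset.Icc k n).filter (fun m : ℕ => (m : ℝ) < a) with hS
  set E := Real.exp (a / (2 * k)) with hE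
  have hE0 : 0 < E := Real.exp_pos _
  have hterm : ∀ m ∈ S, Real.exp (a / (2 * m)) ≤
      E * Real.exp (-(a / (4 * k ^ 2) * ((m - k : ℕ) : ℝ))) + E * Real.exp (-(a / (4 * k))) := by
    intro m hm
    simp only [hS, Finset.mem_filter, Finset.mem_Icc] at hm
    obtain ⟨⟨hkm, _⟩, hma⟩ := hm
    have hm0 : (0 : ℝ) < m := by exact_mod_cast (by omega : 0 < m)
    have hkm' : (k : ℝ) ≤ m := by exact_mod_cast hkm
    rw [hE, ← Real.exp_add, ← Real.exp_add, Nat.cast_sub hkm]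
    rcases le_total (m : ℝ) (2 * k) with h | h
    · have : a / (2 * m) ≤ a / (2 * k) + -(a / (4 * k ^ 2) * ((m : ℝ) - k)) := by
        have e : a / (2 * k) + -(a / (4 * k ^ 2) * ((m : ℝ) - k)) - a / (2 * m)
          = a * ((m - k) * (2 * k - m)) / (4 * k ^ 2 * m) := by field_simp; ring
        have : 0 ≤ a * ((m - k) * (2 * k - m)) / (4 * k ^ 2 * m) := by
          apply div_nonneg _ (by positivity)
          exact mul_nonneg ha0.le (mul_nonneg (by linarith) (by linarith))
        linarith
      have h1 := Real.exp_le_exp.2 this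
      have := Real.exp_pos (a / (2 * k) + -(a / (4 * k)))
      linarith
    · have : a / (2 * m) ≤ a / (2 * k) + -(a / (4 * k)) := by
        have e : a / (2 * k) + -(a / (4 * k)) = a / (4 * k) := by field_simp; ring
        rw [e]
        apply div_le_div_of_nonneg_left ha0.le (by positivity) (by linarith)
      have h1 := Real.exp_le_exp.2 this
      have := Real.exp_pos (a / (2 * k) + -(a / (4 * k ^ 2) * ((m : ℝ) - k)))
      linarith
  refine (Finset.sum_le_sum hterm).trans ?_
  rw [Finset.sum_add_distrib, ← Finset.mul_sum, Finset.sum_const, nsmul_eq_mul]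
  have hA : ∑ m ∈ S, Real.exp (-(a / (4 * k ^ 2) * ((m - k : ℕ) : ℝ))) ≤ 1 + 4 * k ^ 2 / a := by
    have h1 : ∑ m ∈ S, Real.exp (-(a / (4 * k ^ 2) * ((m - k : ℕ) : ℝ)))
        = ∑ d ∈ S.image (fun m => m - k), Real.exp (-(a / (4 * k ^ 2) * (d : ℝ))) := by
      rw [Finset.sum_image]
      intro x hx y hy hxy
      simp only [hS, Finset.coe_filter, Finset.mem_Icc, Set.mem_ofPred_eq] at hx hy
      simp only at hxy
      omega
    rw [h1]
    have h2 := aux_geom (a / (4 * k ^ 2)) (by positivity) (n + 1)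
    have h3 : 1 / (a / (4 * (k:ℝ) ^ 2)) = 4 * k ^ 2 / a := by field_simp
    rw [h3] at h2
    refine le_trans (Finset.sum_le_sum_of_subset_of_nonneg ?_ fun _ _ _ => (Real.exp_pos _).le) h2
    intro d hd
    simp only [hS, Finset.mem_image, Finset.mem_filter, Finset.mem_Icc] at hd
    obtain ⟨m, hm, rfl⟩ := hd
    simp only [Finset.mem_range]; omega
  have hc : (S.card : ℝ) ≤ a := by
    have : S ⊆ Finset.Icc 1 ⌊a⌋₊ := by
      intro m hm
      simp only [hS, Finset.mem_filter, Finset.mem_Icc] at hm ⊢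
      exact ⟨by omega, Nat.le_floor hm.2.le⟩
    have := Finset.card_le_card this
    simp only [Nat.card_Icc, Nat.add_sub_cancel] at this
    exact le_trans (by exact_mod_cast this) (Nat.floor_le ha0.le)
  have hB : a * Real.exp (-(a / (4 * k))) ≤ 32 * (k ^ 2 / a) := by
    have h1 := Real.quadratic_le_exp_of_nonneg (x := a / (4 * k)) (by positivity)
    have h2 : a ^ 2 / (32 * k ^ 2) ≤ Real.exp (a / (4 * k)) := by
      have : (a / (4 * k)) ^ 2 / 2 = a ^ 2 / (32 * k ^ 2) := by field_simp; ring
      have : 0 < a / (4 * k) := by positivity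
      linarith
    rw [Real.exp_neg]
    have h3 : (Real.exp (a / (4 * k)))⁻¹ ≤ (a ^ 2 / (32 * k ^ 2))⁻¹ :=
      inv_anti₀ (by positivity) h2
    refine (mul_le_mul_of_nonneg_left h3 ha0.le).trans (le_of_eq ?_)
    field_simp
  have hC := mul_le_mul_of_nonneg_right hc (Real.exp_pos (-(a / (4 * k)))).le
  have hD : 0 ≤ (k : ℝ) ^ 2 / a := by positivity
  have h4 : 4 * (k : ℝ) ^ 2 / a = 4 * (k ^ 2 / a) := by ring
  rw [h4] at hA
  have := mul_le_mul_of_nonneg_left (show ∑ m ∈ S, Real.exp (-(a / (4 * k ^ 2) * ((m - k : ℕ) : ℝ)))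
    + S.card * Real.exp (-(a / (4 * k))) ≤ 36 * (1 + (k : ℝ) ^ 2 / a) by linarith) hE0.le
  linarith

lemma aux_det (p : ℝ) (hp : 1 < p) (n : ℕ) (lam : ℝ) (hl : 0 < lam) (j : ℕ) :
    ∑ m ∈ Finset.Icc (j + 1) n, ((n : ℝ) / m) ^ (1 / p) * Real.exp (lam ^ 2 / (2 * p * m))
      ≤ 2 * (p * n / (p - 1)) + 36 * (1 + ((j : ℝ) + 1) *
                    min ((lam ^ 2 / (p * ((j : ℝ) + 1))) ^ 2)
                      ((lam ^ 2 / (p * ((j : ℝ) + 1)))⁻¹)) *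
                  ((n : ℝ) / ((j : ℝ) + 1)) ^ (1 / p) *
                  Real.exp (lam ^ 2 / (2 * p * ((j : ℝ) + 1))) := by
  have hp0 : 0 < p := by linarith
  set a := lam ^ 2 / p with ha
  have ha0 : 0 < a := by positivity
  have ee : ∀ m : ℝ, lam ^ 2 / (2 * p * m) = a / (2 * m) := by
    intro m; rw [ha, div_div]; congr 1; ring
  have eu : lam ^ 2 / (p * ((j : ℝ) + 1)) = a / ((j : ℝ) + 1) := by rw [ha, div_div]
  simp only [ee, eu]
  rw [← Finset.sum_filter_add_sum_filter_not (Finset.Icc (j + 1) n) (fun m : ℕ => (m : ℝ) < a)]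
  rw [add_comm]
  apply add_le_add
  · calc _ ≤ ∑ m ∈ (Finset.Icc (j + 1) n).filter (fun m : ℕ => ¬ (m : ℝ) < a),
          2 * ((n : ℝ) / m) ^ (1 / p) := by
          refine Finset.sum_le_sum fun m hm => ?_
          simp only [Finset.mem_filter, Finset.mem_Icc, not_lt] at hm
          have hm0 : (0 : ℝ) < m := by exact_mod_cast (by omega : 0 < m)
          rw [mul_comm]
          apply mul_le_mul_of_nonneg_right _ (by positivity)
          have h1 : a / (2 * m) ≤ 1 / 2 := by
            rw [div_le_div_iff₀ (by positivity) (by norm_num)]; linarith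
          refine (Real.exp_le_exp.2 h1).trans ?_
          have h2 : Real.exp (1 / 2) * Real.exp (1 / 2) = Real.exp 1 := by
            rw [← Real.exp_add]; norm_num
          have := Real.exp_one_lt_d9
          nlinarith [Real.exp_pos (1 / 2)]
      _ ≤ ∑ m ∈ Finset.Icc 1 n, 2 * ((n : ℝ) / m) ^ (1 / p) := by
          refine Finset.sum_le_sum_of_subset_of_nonneg ?_ fun _ _ _ => by positivity
          intro m hm
          simp only [Finset.mem_filter, Finset.mem_Icc] at hm ⊢
          omega
      _ ≤ _ := by
          rw [← Finset.mul_sum]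
          exact mul_le_mul_of_nonneg_left (aux_sum1 p hp n) (by norm_num)
  · have hk0 : (0 : ℝ) < (j : ℝ) + 1 := by positivity
    rcases lt_or_ge ((j : ℝ) + 1) a with h | h
    · have hmin : min ((a / ((j : ℝ) + 1)) ^ 2) ((a / ((j : ℝ) + 1))⁻¹) = (a / ((j : ℝ) + 1))⁻¹ := by
        apply min_eq_right
        have h1 : 1 ≤ a / ((j : ℝ) + 1) := by rw [le_div_iff₀ hk0]; linarith
        exact (inv_le_one_of_one_le₀ h1).trans (one_le_pow₀ h1)
      rw [hmin]
      have h2 := aux_sum2 a (j + 1) (by omega) (by push_cast; exact h) n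
      calc _ ≤ ∑ m ∈ (Finset.Icc (j + 1) n).filter (fun m : ℕ => (m : ℝ) < a),
            ((n : ℝ) / ((j : ℝ) + 1)) ^ (1 / p) * Real.exp (a / (2 * m)) := by
            refine Finset.sum_le_sum fun m hm => ?_
            simp only [Finset.mem_filter, Finset.mem_Icc] at hm
            have hm0 : (j : ℝ) + 1 ≤ m := by exact_mod_cast hm.1.1
            gcongr
        _ ≤ _ := by
            rw [← Finset.mul_sum]
            refine (mul_le_mul_of_nonneg_left h2 (by positivity)).trans (le_of_eq ?_)
            push_cast
            have : ((j : ℝ) + 1) * (a / ((j : ℝ) + 1))⁻¹ = ((j : ℝ) + 1) ^ 2 / a := by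
              field_simp
            rw [this]; ring
    · rw [Finset.sum_eq_zero_iff_of_nonneg (fun _ _ => by positivity) |>.2]
      · positivity
      · intro m hm
        simp only [Finset.mem_filter, Finset.mem_Icc] at hm
        have hm0 : (j : ℝ) + 1 ≤ m := by exact_mod_cast hm.1.1
        linarith

noncomputable def auxT (p : ℝ) (n : ℕ) (lam : ℝ) (m : ℕ) : ℝ :=
  (2 * Real.exp 1 * n / m) ^ (1 / p) * Real.exp (lam ^ 2 / (2 * p * m))

lemma auxT_le (p : ℝ) (hp : 1 < p) (n : ℕ) (lam : ℝ) (m : ℕ) :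
    auxT p n lam m ≤ 6 * (((n : ℝ) / m) ^ (1 / p) * Real.exp (lam ^ 2 / (2 * p * m))) := by
  have hp0 : 0 < p := by linarith
  unfold auxT
  rw [← mul_assoc]
  apply mul_le_mul_of_nonneg_right _ (Real.exp_pos _).le
  rw [mul_div_assoc, Real.mul_rpow (by positivity) (by positivity)]
  apply mul_le_mul_of_nonneg_right _ (by positivity)
  have h1 : (1 : ℝ) ≤ 2 * Real.exp 1 := by linarith [Real.add_one_le_exp (1 : ℝ)]
  refine (Real.rpow_le_rpow_of_exponent_le h1 (y := 1 / p) (z := 1) ?_).trans ?_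
  · rw [div_le_one hp0]; exact hp.le
  · rw [Real.rpow_one]; linarith [Real.exp_one_lt_d9]

lemma auxT_one_le (p : ℝ) (hp : 1 < p) (n : ℕ) (lam : ℝ) (m : ℕ) (hm : 1 ≤ m) (hmn : m ≤ n) :
    1 ≤ auxT p n lam m := by
  have hp0 : 0 < p := by linarith
  have hm0 : (0 : ℝ) < m := by exact_mod_cast hm
  have hmn' : (m : ℝ) ≤ n := by exact_mod_cast hmn
  unfold auxT
  apply one_le_mul_of_one_le_of_one_le
  · apply Real.one_le_rpow _ (by positivity)
    rw [le_div_iff₀ hm0]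
    nlinarith [Real.add_one_le_exp (1 : ℝ)]
  · apply Real.one_le_exp; positivity

lemma auxT_prob (p : ℝ) (hp : 1 < p) (n : ℕ) (lam : ℝ) (m : ℕ) (hm : 1 ≤ m) (hmn : m ≤ n) :
    (n.choose m : ℝ) * (auxT p n lam m ^ (-p)) ^ m ≤ (1 / 2) ^ m * Real.exp (-lam ^ 2 / 2) := by
  have hp0 : 0 < p := by linarith
  have hm0 : (0 : ℝ) < m := by exact_mod_cast hm
  have hn0 : (0 : ℝ) < n := by exact_mod_cast (by omega : 0 < n)
  have e1 : auxT p n lam m ^ (-p) = (2 * Real.exp 1 * n / m)⁻¹ * Real.exp (-lam ^ 2 / (2 * m)) := by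
    unfold auxT
    rw [Real.mul_rpow (by positivity) (Real.exp_pos _).le, ← Real.rpow_mul (by positivity),
      ← Real.exp_mul]
    congr 1
    · rw [show 1 / p * -p = -1 by field_simp, Real.rpow_neg_one]
    · congr 1; field_simp
  rw [e1, mul_pow, ← Real.exp_nat_mul, show (m : ℝ) * (-lam ^ 2 / (2 * m)) = -lam ^ 2 / 2 by
    field_simp, ← mul_assoc]
  apply mul_le_mul_of_nonneg_right _ (Real.exp_pos _).le
  have h1 : (n.choose m : ℝ) ≤ (n : ℝ) ^ m / m.factorial := Nat.choose_le_pow_div m n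
  have h2 := Real.pow_div_factorial_le_exp (x := (m : ℝ)) hm0.le m
  have hf : (0 : ℝ) < m.factorial := by exact_mod_cast m.factorial_pos
  refine (mul_le_mul_of_nonneg_right h1 (by positivity)).trans ?_
  have e2 : (2 * Real.exp 1 * n / m)⁻¹ ^ m = (1 / 2) ^ m * ((m : ℝ) ^ m / (Real.exp m * n ^ m)) := by
    rw [show Real.exp (m : ℝ) = Real.exp 1 ^ m by rw [← Real.exp_nat_mul, mul_one], ← mul_pow,
      ← div_pow, ← mul_pow]
    congr 1; field_simp
  rw [e2]
  have e3 : (n : ℝ) ^ m / m.factorial * ((1 / 2) ^ m * ((m : ℝ) ^ m / (Real.exp m * n ^ m)))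
    = (1 / 2) ^ m * ((m : ℝ) ^ m / m.factorial / Real.exp m) := by
    field_simp
  rw [e3]
  apply mul_le_of_le_one_right (by positivity)
  rw [div_le_one (Real.exp_pos _)]
  exact h2

lemma aux_half (n : ℕ) : ∑ m ∈ Finset.Icc 1 n, ((1 : ℝ) / 2) ^ m ≤ 1 := by
  have : ∑ m ∈ Finset.Icc 1 n, ((1 : ℝ) / 2) ^ m = 1 - (1 / 2) ^ n := by
    induction n with
    | zero => simp
    | succ n ih => rw [Finset.sum_Icc_succ_top (by omega), ih, pow_succ]; ring
  rw [this]
  have : (0 : ℝ) < (1 / 2) ^ n := by positivity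
  linarith

lemma aux_order {n : ℕ} (v : Fin n → ℝ) (i : Fin n) (t : ℝ) (h : t < orderStat v i) :
    ∃ s ∈ (Finset.univ : Finset (Fin n)).powersetCard (n - i), ∀ x ∈ s, t < v x := by
  refine ⟨(Finset.Ici i).map (Tuple.sort v).toEmbedding, ?_, ?_⟩
  · simp [Finset.mem_powersetCard]
  · intro x hx
    simp only [Finset.mem_map, Finset.mem_Ici] at hx
    obtain ⟨k, hk, rfl⟩ := hx
    exact lt_of_lt_of_le h (Tuple.monotone_sort v hk)

lemma aux_meas {Ω : Type} [MeasurableSpace Ω] (μ : Measure Ω) (ν : Measure ℝ)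
    [IsProbabilityMeasure ν] {n : ℕ} (Y : Fin n → Ω → ℝ) (hY : ∀ i, Measurable (Y i))
    (hmap : μ.map (fun ω i => Y i ω) = Measure.pi (fun _ : Fin n => ν))
    (s : Finset (Fin n)) (t : ℝ) :
    μ {ω | ∀ x ∈ s, t < Y x ω} = ν (Ioi t) ^ s.card := by
  classical
  have e : {ω | ∀ x ∈ s, t < Y x ω} = (fun ω i => Y i ω) ⁻¹'
      (Set.pi univ (fun x => if x ∈ s then Ioi t else univ)) := by
    ext ω
    simp only [Set.mem_ofPred_eq, Set.mem_preimage, Set.mem_univ_pi]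
    refine forall_congr' fun x => ?_
    by_cases hx : x ∈ s <;> simp [hx]
  rw [e, ← Measure.map_apply (measurable_pi_lambda _ hY), hmap, Measure.pi_pi]
  · have : ∀ x, ν (if x ∈ s then Ioi t else univ) = if x ∈ s then ν (Ioi t) else 1 := by
      intro x; split_ifs <;> simp
    simp [this, Finset.prod_ite]
  · refine MeasurableSet.univ_pi fun x => ?_
    split_ifs
    · exact measurableSet_Ioi
    · exact MeasurableSet.univ

lemma aux_bad {Ω : Type} [MeasurableSpace Ω] (μ : Measure Ω) (ν : Measure ℝ)
    [IsProbabilityMeasure ν] (p : ℝ) (hp : 1 < p) (lam : ℝ)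
    (hν : ∀ t : ℝ, 1 ≤ t → ν (Set.Ioi t) = ENNReal.ofReal (t ^ (-p)))
    {n : ℕ} (Y : Fin n → Ω → ℝ) (hY : ∀ i, Measurable (Y i))
    (hmap : μ.map (fun ω i => Y i ω) = Measure.pi (fun _ : Fin n => ν)) :
    μ {ω | ¬ ∀ i : Fin n, orderStat (fun i' => Y i' ω) i ≤ auxT p n lam (n - i)}
      ≤ ENNReal.ofReal (Real.exp (-lam ^ 2 / 2)) := by
  have hsub : {ω | ¬ ∀ i : Fin n, orderStat (fun i' => Y i' ω) i ≤ auxT p n lam (n - i)} ⊆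
      ⋃ m ∈ Finset.Icc 1 n, ⋃ s ∈ (Finset.univ : Finset (Fin n)).powersetCard m,
        {ω | ∀ x ∈ s, auxT p n lam m < Y x ω} := by
    intro ω hω
    simp only [Set.mem_ofPred_eq, not_forall, not_le] at hω
    obtain ⟨i, hi⟩ := hω
    obtain ⟨s, hs, hs2⟩ := aux_order _ i _ hi
    simp only [Set.mem_iUnion]
    exact ⟨n - i, Finset.mem_Icc.2 ⟨by omega, by omega⟩, s, hs, hs2⟩
  refine (measure_mono hsub).trans ?_
  refine (measure_biUnion_finset_le _ _).trans ?_
  have hstep : ∀ m ∈ Finset.Icc 1 n, μ (⋃ s ∈ (Finset.univ : Finset (Fin n)).powersetCard m,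
        {ω | ∀ x ∈ s, auxT p n lam m < Y x ω}) ≤
        ENNReal.ofReal ((1 / 2) ^ m * Real.exp (-lam ^ 2 / 2)) := by
    intro m hm
    rw [Finset.mem_Icc] at hm
    refine (measure_biUnion_finset_le _ _).trans ?_
    have hT := auxT_one_le p hp n lam m hm.1 hm.2
    have h0 : 0 ≤ auxT p n lam m ^ (-p) := Real.rpow_nonneg (by linarith) _
    have e : ∀ s ∈ (Finset.univ : Finset (Fin n)).powersetCard m,
        μ {ω | ∀ x ∈ s, auxT p n lam m < Y x ω} = ENNReal.ofReal ((auxT p n lam m ^ (-p)) ^ m) := by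
      intro s hs
      rw [aux_meas μ ν Y hY hmap, (Finset.mem_powersetCard.1 hs).2, hν _ hT, ENNReal.ofReal_pow h0]
    rw [Finset.sum_congr rfl e, Finset.sum_const, Finset.card_powersetCard, Finset.card_univ,
      Fintype.card_fin, ← ENNReal.ofReal_nsmul, nsmul_eq_mul]
    exact ENNReal.ofReal_le_ofReal (auxT_prob p hp n lam m hm.1 hm.2)
  refine (Finset.sum_le_sum hstep).trans ?_
  rw [← ENNReal.ofReal_sum_of_nonneg (fun _ _ => by positivity), ← Finset.sum_mul]
  apply ENNReal.ofReal_le_ofReal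
  exact mul_le_of_le_one_left (Real.exp_pos _).le (aux_half n)

lemma aux_orderSum {n : ℕ} (v : Fin n → ℝ) (f : ℕ → ℝ)
    (h : ∀ i : Fin n, orderStat v i ≤ f (n - i)) (j : ℕ) :
    (∑ i : Fin n, if (i : ℕ) + 1 ≤ n - j then orderStat v i else 0)
      ≤ ∑ m ∈ Finset.Icc (j + 1) n, f m := by
  rw [← Finset.sum_filter]
  refine (Finset.sum_le_sum fun i _ => h i).trans (le_of_eq ?_)
  refine Finset.sum_bij (fun i _ => n - (i : ℕ)) ?_ ?_ ?_ ?_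
  · intro i hi
    simp only [Finset.mem_filter, Finset.mem_univ, true_and] at hi
    rw [Finset.mem_Icc]; omega
  · intro a _ b _ hab
    apply Fin.ext; have := a.2; have := b.2; omega
  · intro m hm
    rw [Finset.mem_Icc] at hm
    refine ⟨⟨n - m, by omega⟩, ?_, ?_⟩
    · simp only [Finset.mem_filter, Finset.mem_univ, true_and]; omega
    · simp only; omega
  · intro i _; rfl

/-- There is a universal constant `C > 0` such that for every `p > 1`,
`n ∈ ℕ`, `λ > 0` and i.i.d. Pareto random variables `(Y_i)₁ⁿ` with
`ℙ{Y_i > t} = t^{−p}` for `t ≥ 1` (and `Y_i ≥ 1` a.s.), with probability at least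
`1 − C·exp(−λ²/2)`: for every integer `0 ≤ j ≤ n/2`,
`∑_{i=1}^{n−j} Y_{(i)} ≤ C·p·n/(p−1)
  + C·(1+(j+1)·min{(λ²/(p(j+1)))², (λ²/(p(j+1)))⁻¹})·(n/(j+1))^{1/p}·exp(λ²/(2p(j+1)))`. -/
theorem stmt_16 :
    ∃ C : ℝ, 0 < C ∧
      ∀ (p : ℝ), 1 < p → ∀ (n : ℕ) (lam : ℝ), 0 < lam →
      ∀ (Ω : Type) (_ : MeasurableSpace Ω) (μ : Measure Ω), IsProbabilityMeasure μ →
      ∀ (ν : Measure ℝ), IsProbabilityMeasure ν →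
        (∀ t : ℝ, 1 ≤ t → ν (Set.Ioi t) = ENNReal.ofReal (t ^ (-p))) →
        ν (Set.Iio 1) = 0 →
      ∀ (Y : Fin n → Ω → ℝ), (∀ i, Measurable (Y i)) →
        μ.map (fun ω i => Y i ω) = Measure.pi (fun _ : Fin n => ν) →
        ENNReal.ofReal (1 - C * Real.exp (-lam ^ 2 / 2)) ≤
          μ {ω | ∀ j : ℕ, (j : ℝ) ≤ (n : ℝ) / 2 →
            (∑ i : Fin n, if (i : ℕ) + 1 ≤ n - j then orderStat (fun i' => Y i' ω) i else 0)
              ≤ C * p * (n : ℝ) / (p - 1) +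
                C * (1 + ((j : ℝ) + 1) *
                    min ((lam ^ 2 / (p * ((j : ℝ) + 1))) ^ 2)
                      ((lam ^ 2 / (p * ((j : ℝ) + 1)))⁻¹)) *
                  ((n : ℝ) / ((j : ℝ) + 1)) ^ (1 / p) *
                  Real.exp (lam ^ 2 / (2 * p * ((j : ℝ) + 1)))} := by
  refine ⟨216, by norm_num, ?_⟩
  intro p hp n lam hl Ω _ μ hμ ν hν hνt _ Y hY hmap
  have hbad := aux_bad μ ν p hp lam hνt Y hY hmap
  have hp0 : 0 < p := by linarith
  have hp1 : 0 < p - 1 := by linarith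
  set B := {ω | ¬ ∀ i : Fin n, orderStat (fun i' => Y i' ω) i ≤ auxT p n lam (n - i)} with hB
  refine le_trans ?_ (measure_mono (s := Bᶜ) ?_)
  · have h1 : (1 : ENNReal) ≤ μ Bᶜ + ENNReal.ofReal (Real.exp (-lam ^ 2 / 2)) := by
      calc (1 : ENNReal) = μ (Bᶜ ∪ B) := by rw [Set.compl_union_self, measure_univ]
        _ ≤ μ Bᶜ + μ B := measure_union_le _ _
        _ ≤ _ := by gcongr
    have h2 : ENNReal.ofReal (1 - Real.exp (-lam ^ 2 / 2)) ≤ μ Bᶜ := by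
      rw [ENNReal.ofReal_sub _ (Real.exp_pos _).le, ENNReal.ofReal_one]
      exact tsub_le_iff_right.2 h1
    refine le_trans (ENNReal.ofReal_le_ofReal ?_) h2
    linarith [Real.exp_pos (-lam ^ 2 / 2)]
  · intro ω hω
    simp only [hB, Set.mem_compl_iff, Set.mem_ofPred_eq, not_not] at hω
    intro j _
    have h3 := aux_orderSum _ _ hω j
    have h4 := aux_det p hp n lam hl j
    have h5 : ∑ m ∈ Finset.Icc (j + 1) n, auxT p n lam m ≤ 6 * ∑ m ∈ Finset.Icc (j + 1) n,
        ((n : ℝ) / m) ^ (1 / p) * Real.exp (lam ^ 2 / (2 * p * m)) := by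
      rw [Finset.mul_sum]
      exact Finset.sum_le_sum fun m _ => auxT_le p hp n lam m
    have h6 : 0 ≤ p * n / (p - 1) := by positivity
    have h7 : 216 * p * (n : ℝ) / (p - 1) = 216 * (p * n / (p - 1)) := by ring
    rw [h7]
    refine h3.trans (h5.trans ?_)
    refine (mul_le_mul_of_nonneg_left h4 (by norm_num)).trans ?_
    rw [mul_add]
    apply add_le_add
    · linarith
    · apply le_of_eq; ring
end
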